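/- arXiv:2401.11461 — 3 statements merged into one kernel-verified Lean document; each statement's English description precedes it below -/
import Mathlib

section
/- A ring R is a UWNC ring if and only if the Jacobson radical J(R) is a nil ideal and the quotient ring R/J(R) is a UWNC ring. -/
/-- An element of a ring is *weakly nil-clean* if it is `e + n` or `-e + n`
for an idempotent `e` and a nilpotent `n`. -/
def IsWeaklyNilClean {R : Type*} [Ring R] (a : R) : Prop :=
  ∃ e n : R, IsIdempotentElem e ∧ IsNilpotent n ∧ (a = e + n ∨ a = -e + n)

/-- An element of a ring is *nil-clean* if it is `e + n`
for an idempotent `e` and a nilpotent `n`. -/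
def IsNilClean {R : Type*} [Ring R] (a : R) : Prop :=
  ∃ e n : R, IsIdempotentElem e ∧ IsNilpotent n ∧ a = e + n

/-- A ring is *UWNC* if every unit is weakly nil-clean. -/
def IsUWNC (R : Type*) [Ring R] : Prop :=
  ∀ u : Rˣ, IsWeaklyNilClean (u : R)

/-- A ring is *UNC* if every unit is nil-clean. -/
def IsUNC (R : Type*) [Ring R] : Prop :=
  ∀ u : Rˣ, IsNilClean (u : R)

/-- A ring is *WUU* if every unit is of the form `n + 1` or `n - 1`
for a nilpotent `n`. -/
def IsWUU (R : Type*) [Ring R] : Prop :=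
  ∀ u : Rˣ, ∃ n : R, IsNilpotent n ∧ ((u : R) = n + 1 ∨ (u : R) = n - 1)

theorem eq_zero_of_mul_eq_self_of_isNilpotent {S : Type*} [MonoidWithZero S] {q m : S}
    (h : q * m = q) (hm : IsNilpotent m) : q = 0 := by
  obtain ⟨k, hk⟩ := hm
  have hq : ∀ i : ℕ, q * m ^ i = q := by
    intro i
    induction i with
    | zero => simp
    | succ i ih => rw [pow_succ, ← mul_assoc, ih, h]
  rw [← hq k, hk, mul_zero]

theorem IsIdempotentElem.eq_one_of_isUnit {S : Type*} [Monoid S] {e : S}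
    (he : IsIdempotentElem e) (hu : IsUnit e) : e = 1 :=
  hu.mul_left_cancel (by rw [he.eq, mul_one])

theorem TwoSidedIdeal.isUnit_one_add_of_mem_jacobson_bot {R : Type*} [Ring R] {x : R}
    (hx : x ∈ (⊥ : TwoSidedIdeal R).jacobson) : IsUnit (1 + x) := by
  have left_inv : ∀ y ∈ (⊥ : TwoSidedIdeal R).jacobson, ∃ z, z * (1 + y) = 1 := by
    intro y hy
    obtain ⟨z, hz⟩ := TwoSidedIdeal.mem_jacobson_iff.1 hy 1
    rw [TwoSidedIdeal.mem_bot, sub_eq_zero, mul_one] at hz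
    exact ⟨z, by rw [mul_add, mul_one, add_comm, hz]⟩
  obtain ⟨z, hz⟩ := left_inv x hx
  obtain ⟨w, hw⟩ := left_inv (-(z * x))
    (TwoSidedIdeal.neg_mem _ (TwoSidedIdeal.mul_mem_left _ _ _ hx))
  have hzx : 1 + -(z * x) = z := by rw [← hz]; noncomm_ring
  rw [hzx] at hw
  have hwx : w = 1 + x := left_inv_eq_right_inv hw hz
  exact ⟨⟨1 + x, z, hwx ▸ hw, hz⟩, rfl⟩

theorem IsWeaklyNilClean.map {R S : Type*} [Ring R] [Ring S] (f : R →+* S) {a : R}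
    (ha : IsWeaklyNilClean a) : IsWeaklyNilClean (f a) := by
  obtain ⟨e, n, he, hn, h⟩ := ha
  refine ⟨f e, f n, he.map f, hn.map f, ?_⟩
  rcases h with rfl | rfl <;> simp

section KernelUnits

variable {R S : Type*} [Ring R] [Ring S] {f : R →+* S}

theorem isLocalHom_of_isUnit_one_add_of_surjective
    (hker : ∀ x, f x = 0 → IsUnit (1 + x)) (hf : Function.Surjective f) : IsLocalHom f where
  map_nonunit a ha := by
    have key : ∀ b, f b = 1 → IsUnit b := fun b hb => by
      simpa using hker (b - 1) (by simp [hb])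
    obtain ⟨u, hu⟩ := ha
    obtain ⟨v, hv⟩ := hf ↑u⁻¹
    obtain ⟨r, hr⟩ := (key (a * v) (by simp [← hu, hv])).exists_right_inv
    obtain ⟨l, hl⟩ := (key (v * a) (by simp [← hu, hv])).exists_left_inv
    exact isUnit_iff_exists_and_exists.2
      ⟨⟨v * r, by rw [← mul_assoc, hr]⟩, ⟨l * v, by rw [mul_assoc, hl]⟩⟩

/-- If every element of `1 + ker f` is a unit, idempotents congruent to `1` are equal to `1`. -/
theorem IsIdempotentElem.eq_one_of_map_eq_one
    (hker : ∀ x, f x = 0 → IsUnit (1 + x)) {e : R} (he : IsIdempotentElem e) (h : f e = 1) :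
    e = 1 :=
  he.eq_one_of_isUnit (by simpa using hker (e - 1) (by simp [h]))

theorem IsUWNC.isNilpotent_or_isNilpotent_add_two (hR : IsUWNC R)
    (hker : ∀ x, f x = 0 → IsUnit (1 + x)) {x : R} (hx : f x = 0) :
    IsNilpotent x ∨ (IsNilpotent (x + 2) ∧ IsNilpotent (f 2)) := by
  obtain ⟨u, hu⟩ := hker x hx
  obtain ⟨e, n, he, hn, h⟩ := hR u
  rw [hu] at h
  have e_eq_one (hfn : (1 - f e) * f n = 1 - f e) : e = 1 :=
    he.eq_one_of_map_eq_one hker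
      (sub_eq_zero.1 (eq_zero_of_mul_eq_self_of_isNilpotent hfn (hn.map f))).symm
  have hfe : f e * f e = f e := he.map f
  rcases h with h | h
  · left
    have hfn : f n = 1 - f e := by
      rw [eq_sub_iff_add_eq', ← map_add, ← h, map_add, hx, map_one, add_zero]
    have he1 := e_eq_one (by rw [hfn]; simp [mul_sub, sub_mul, hfe])
    rw [he1] at h
    rwa [add_left_cancel h]
  · right
    have hn' : n = x + 1 + e := by rw [add_comm x 1, h]; abel
    have hfn : f n = 1 + f e := by simp [hn', hx]
    have he1 := e_eq_one (by rw [hfn]; simp [mul_add, sub_mul, hfe])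
    have hn2 : n = x + 2 := by rw [hn', he1, add_assoc, one_add_one_eq_two]
    refine ⟨hn2 ▸ hn, ?_⟩
    simpa [hn2, hx] using hn.map f

theorem IsUWNC.isNilpotent_of_map_eq_zero (hR : IsUWNC R)
    (hker : ∀ x, f x = 0 → IsUnit (1 + x)) {x : R} (hx : f x = 0) : IsNilpotent x := by
  rcases hR.isNilpotent_or_isNilpotent_add_two hker hx with h | ⟨h, k, hk⟩
  · exact h
  have hfk : f (2 ^ k) = 0 := by simp [hk]
  have two_nilpotent : IsNilpotent (2 : R) := by
    rcases hR.isNilpotent_or_isNilpotent_add_two hker (x := 2 * 2 ^ k) (by simp [hk])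
      with h2 | ⟨h2, -⟩
    · rw [← pow_succ'] at h2
      exact h2.of_pow
    · have heq : (2 * 2 ^ k + 2 : R) = 2 * (1 + 2 ^ k) := by rw [mul_add, mul_one, add_comm]
      rw [heq] at h2
      refine ((hker _ hfk).isNilpotent_mul_unit_of_commute_iff ?_).1 h2
      exact Commute.ofNat_left 2 _
  have hcomm : Commute (x + 2) (2 : R) := Commute.ofNat_right _ 2
  simpa using hcomm.isNilpotent_sub h two_nilpotent

theorem IsUWNC.of_surjective (hR : IsUWNC R)
    (hker : ∀ x, f x = 0 → IsUnit (1 + x)) (hf : Function.Surjective f) : IsUWNC S := by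
  intro u
  obtain ⟨a, ha⟩ := hf u
  have := isLocalHom_of_isUnit_one_add_of_surjective hker hf
  obtain ⟨v, rfl⟩ := isUnit_of_map_unit f a (ha ▸ u.isUnit)
  exact ha ▸ (hR v).map f

theorem IsUWNC.of_ker_isNilpotent (hS : IsUWNC S)
    (hker : ∀ x, f x = 0 → IsNilpotent x) (hf : Function.Surjective f) : IsUWNC R := by
  intro u
  have nilpotent_of_map : ∀ y, IsNilpotent (f y) → IsNilpotent y := by
    rintro y ⟨k, hk⟩
    exact (hker (y ^ k) (by rw [map_pow, hk])).of_pow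
  obtain ⟨e, n, he, hn, h⟩ := hS (Units.map (f : R →* S) u)
  obtain ⟨e', he', rfl⟩ := exists_isIdempotentElem_eq_of_ker_isNilpotent f
    (fun x hx => hker x hx) e (hf e) he
  have hu : f u = f e' + n ∨ f u = -f e' + n := h
  rcases hu with hu | hu
  · exact ⟨e', u - e', he', nilpotent_of_map _ (by simpa [hu] using hn), Or.inl (by abel)⟩
  · exact ⟨e', u + e', he', nilpotent_of_map _ (by simpa [hu] using hn), Or.inr (by abel)⟩

end KernelUnits

theorem isUWNC_iff_jacobson_nil_and_quotient {R : Type*} [Ring R] :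
    IsUWNC R ↔
      (∀ x ∈ (⊥ : TwoSidedIdeal R).jacobson, IsNilpotent x) ∧
        IsUWNC ((⊥ : TwoSidedIdeal R).jacobson.ringCon.Quotient) := by
  have map_eq_zero : ∀ x : R, (⊥ : TwoSidedIdeal R).jacobson.ringCon.mk' x = 0 ↔
      x ∈ (⊥ : TwoSidedIdeal R).jacobson := by
    intro x
    rw [← TwoSidedIdeal.mem_ker, TwoSidedIdeal.ker_ringCon_mk']
  have hsurj := RingCon.mk'_surjective (⊥ : TwoSidedIdeal R).jacobson.ringCon
  constructor
  · intro hR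
    have hker : ∀ x : R, (⊥ : TwoSidedIdeal R).jacobson.ringCon.mk' x = 0 → IsUnit (1 + x) :=
      fun x hx => TwoSidedIdeal.isUnit_one_add_of_mem_jacobson_bot ((map_eq_zero x).1 hx)
    exact ⟨fun x hx => hR.isNilpotent_of_map_eq_zero hker ((map_eq_zero x).2 hx),
      hR.of_surjective hker hsurj⟩
  · rintro ⟨hnil, hQ⟩
    exact hQ.of_ker_isNilpotent (fun x hx => hnil x ((map_eq_zero x).1 hx)) hsurj
end

section
/- For any nontrivial ring R (a ring in which 1 ≠ 0), the formal power series ring R[[x]] is not a UWNC ring. -/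
/-- A commuting nilpotent perturbation of an idempotent that is a unit forces the idempotent
to be `1`. -/
theorem IsIdempotentElem.eq_one_of_isUnit_add {S : Type*} [Ring S] {e n : S}
    (he : IsIdempotentElem e) (hn : IsNilpotent n) (hu : IsUnit (e + n)) (hc : Commute e n) :
    e = 1 := by
  have h : IsUnit (e + n + -n) :=
    hn.neg.isUnit_add_left_of_commute hu ((hc.symm.add_right (Commute.refl n)).neg_left)
  rw [add_neg_cancel_right] at h
  exact h.mul_left_cancel (he.eq.trans (mul_one e).symm)

theorem PowerSeries.not_isNilpotent_X_add_C {R : Type*} [Ring R] [Nontrivial R] (c : R) :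
    ¬ IsNilpotent (PowerSeries.X + PowerSeries.C c) := by
  rintro ⟨k, hk⟩
  have h : Polynomial.coeToPowerSeries.ringHom ((Polynomial.X + Polynomial.C c) ^ k) = 0 := by
    rw [map_pow, map_add]
    simpa using hk
  have h0 : (Polynomial.X + Polynomial.C c) ^ k = 0 :=
    Polynomial.coe_injective R (by simpa using h)
  exact ((Polynomial.monic_X_add_C c).pow k).ne_zero h0

theorem PowerSeries.isUnit_one_sub_X (R : Type*) [Ring R] :
    IsUnit (1 - PowerSeries.X : PowerSeries R) := by
  have h : (PowerSeries.mk 1 : PowerSeries R) * (1 - PowerSeries.X) = 1 := by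
    ext k
    cases k <;> simp [mul_sub, PowerSeries.coeff_succ_mul_X, PowerSeries.coeff_one]
  have hc : Commute (PowerSeries.mk 1 : PowerSeries R) (1 - PowerSeries.X) :=
    (Commute.one_right _).sub_right (PowerSeries.commute_X _)
  exact ⟨⟨1 - PowerSeries.X, PowerSeries.mk 1, hc.eq.symm.trans h, h⟩, rfl⟩

theorem powerSeries_not_isUWNC {R : Type*} [Ring R] [Nontrivial R] :
    ¬ IsUWNC (PowerSeries R) := by
  intro h
  have hX := PowerSeries.isUnit_one_sub_X R
  obtain ⟨e, n, he, hn, hu⟩ := h hX.unit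
  rw [IsUnit.unit_spec] at hu
  have hcX : Commute e (1 - PowerSeries.X) :=
    (Commute.one_right _).sub_right (PowerSeries.commute_X _)
  rcases hu with hu | hu
  · have hc : Commute e n := by
      rw [← sub_eq_iff_eq_add'.mpr hu]
      exact hcX.sub_right (Commute.refl e)
    have he1 := he.eq_one_of_isUnit_add hn (hu ▸ hX) hc
    have hX_eq : PowerSeries.X + PowerSeries.C (0 : R) = -n := by
      rw [he1] at hu
      rw [← sub_eq_iff_eq_add'.mpr hu, map_zero]
      abel
    exact PowerSeries.not_isNilpotent_X_add_C (0 : R) (hX_eq ▸ hn.neg)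
  · have hn' : n = (1 - PowerSeries.X) + e := by rw [hu]; abel
    have hc : Commute e (-n) := by
      rw [hn']
      exact (hcX.add_right (Commute.refl e)).neg_right
    have hv : IsUnit (e + -n) := by
      convert hX.neg using 1
      rw [hu]; abel
    have he1 := he.eq_one_of_isUnit_add hn.neg hv hc
    have hX_eq : PowerSeries.X + PowerSeries.C (-1 - 1 : R) = -n := by
      rw [hn', he1, map_sub, map_neg, map_one]
      abel
    exact PowerSeries.not_isNilpotent_X_add_C (-1 - 1 : R) (hX_eq ▸ hn.neg)
end

section
/- Let R be a local ring (a ring with a unique maximal left ideal, equivalently: the sum of any two non-units is a non-unit). Then R is a UWNC ring if and only if R is a weakly nil-clean ring. -/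
theorem IsIdempotentElem.eq_zero_or_eq_one_of_isLocalRing {R : Type*} [Ring R] [IsLocalRing R]
    {e : R} (he : IsIdempotentElem e) : e = 0 ∨ e = 1 := by
  rcases IsLocalRing.isUnit_or_isUnit_of_add_one (add_sub_cancel e 1) with h | h
  · right
    exact h.mul_left_cancel (by rw [he.eq, mul_one])
  · left
    exact h.mul_left_cancel (by rw [sub_mul, one_mul, he.eq, sub_self, mul_zero])

theorem IsUWNC.isNilpotent_sub_one_or_add_one {R : Type*} [Ring R] [IsLocalRing R]
    (h : IsUWNC R) {u : R} (hu : IsUnit u) : IsNilpotent (u - 1) ∨ IsNilpotent (u + 1) := by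
  obtain ⟨e, n, he, hn, h'⟩ := h hu.unit
  rw [IsUnit.unit_spec] at h'
  rcases he.eq_zero_or_eq_one_of_isLocalRing with rfl | rfl
  · have hun : u = n := by simpa using h'
    exact absurd (hun ▸ hu) hn.not_isUnit
  · rcases h' with rfl | rfl
    · left; simpa using hn
    · right; simpa [add_comm, add_left_comm] using hn

theorem IsUWNC.isNilpotent_two {R : Type*} [Ring R] [IsLocalRing R]
    (h : IsUWNC R) (h2 : ¬IsUnit (2 : R)) : IsNilpotent (2 : R) := by
  have h3 : IsUnit (3 : R) := by
    rcases IsLocalRing.isUnit_or_isUnit_of_add_one (a := (3 : R)) (b := -2) (by norm_num)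
      with h3 | h3
    · exact h3
    · exact absurd (by simpa using h3.neg) h2
  rcases h.isNilpotent_sub_one_or_add_one h3 with hn | hn
  · convert hn using 1; norm_num
  · rw [show (3 : R) + 1 = 2 ^ 2 by norm_num] at hn
    exact (IsNilpotent.pow_iff_pos two_ne_zero).1 hn

theorem IsUWNC.isNilpotent_of_not_isUnit {R : Type*} [Ring R] [IsLocalRing R]
    (h : IsUWNC R) {a : R} (ha : ¬IsUnit a) : IsNilpotent a := by
  have hu : IsUnit (1 - a) :=
    (IsLocalRing.isUnit_or_isUnit_of_add_one (add_sub_cancel a 1)).resolve_left ha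
  rcases h.isNilpotent_sub_one_or_add_one hu with hn | hn
  · simpa using hn
  · have h2a : 1 - a + 1 = 2 - a := by rw [← one_add_one_eq_two]; abel
    rw [h2a] at hn
    have h2 : ¬IsUnit (2 : R) := fun h2 ↦
      (IsLocalRing.isUnit_or_isUnit_of_isUnit_add
        (a := a) (b := 2 - a) (by simpa using h2)).elim ha hn.not_isUnit
    have hc : Commute (2 : R) (2 - a) := Commute.ofNat_left 2 _
    simpa using hc.isNilpotent_sub (h.isNilpotent_two h2) hn

theorem isUWNC_iff_weakly_nil_clean_of_local {R : Type*} [Ring R] [IsLocalRing R] :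
    IsUWNC R ↔ ∀ a : R, IsWeaklyNilClean a := by
  refine ⟨fun h a ↦ ?_, fun h u ↦ h u⟩
  by_cases ha : IsUnit a
  · exact h ha.unit
  · exact ⟨0, a, .zero, h.isNilpotent_of_not_isUnit ha, .inl (zero_add a).symm⟩
end
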